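/- arXiv:2303.02802 — 4 statements merged into one kernel-verified Lean document; each statement's English description precedes it below -/
import Mathlib

section
/- Let q = 2^k with k ≥ 2, let r ∈ {0,1} (as a natural number), and let E be an integer with −q/2 < E ≤ q/2. Let Q : ZMod q → {0,1} be the quantization function. Then Q(((r·(q/2) + E : ℤ) : ZMod q)) = r if and only if −q/4 < E and E ≤ q/4. In particular, a decryption error occurs exactly when the accumulated error exceeds the decision threshold q/4 in absolute value (with the stated boundary convention). -/
/-- The quantization function `Q` of the lattice PUF: `Q x = 0` if the canonical
representative of `x` lies in `[0, q/4] ∪ (3q/4, q-1]`, and `Q x = 1` if it lies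
in `(q/4, 3q/4]`. -/
def Q (q : ℕ) (x : ZMod q) : ℕ :=
  if x.val ≤ q / 4 ∨ 3 * q / 4 < x.val then 0 else 1

/-- **Decryption error characterization.** For `q = 2^k`, `k ≥ 2`, a bit `r ∈ {0,1}`,
and an integer error `E` with `-q/2 < E ≤ q/2`, quantization recovers the bit,
i.e. `Q (r * (q/2) + E) = r`, if and only if `-q/4 < E ≤ q/4`. -/
theorem quantize_noisy_iff (q k : ℕ) (hq : q = 2 ^ k) (hk : 2 ≤ k)
    (r : ℕ) (hr : r = 0 ∨ r = 1) (E : ℤ)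
    (hE₁ : -((q : ℤ) / 2) < E) (hE₂ : E ≤ (q : ℤ) / 2) :
    Q q ((((r * (q / 2) : ℕ) : ℤ) + E : ℤ) : ZMod q) = r ↔
      (-((q : ℤ) / 4) < E ∧ E ≤ (q : ℤ) / 4) := by
  obtain ⟨m, rfl⟩ : 4 ∣ q := hq ▸ pow_dvd_pow 2 hk
  have hm : 0 < m := by
    have : 0 < 4 * m := hq ▸ Nat.two_pow_pos k
    omega
  have : NeZero (4 * m) := ⟨by omega⟩
  have hhalf : 4 * m / 2 = 2 * m := by omega
  rw [hhalf]
  have hval := ZMod.val_intCast (n := 4 * m) (((r * (2 * m) : ℕ) : ℤ) + E)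
  unfold Q
  generalize ZMod.val (((((r * (2 * m) : ℕ) : ℤ) + E : ℤ) : ZMod (4 * m))) = v at hval ⊢
  obtain ⟨x, hx⟩ : ∃ x : ℤ, x = ((r * (2 * m) : ℕ) : ℤ) + E := ⟨_, rfl⟩
  rw [← hx] at hval
  have hx' : x = E ∧ r = 0 ∨ x = 2 * m + E ∧ r = 1 := by
    rcases hr with rfl | rfl <;> simp [hx]
  have hpos : (0 : ℤ) < (4 * m : ℕ) := by omega
  have hv₀ := Int.emod_nonneg x hpos.ne'
  have hv₁ := Int.emod_lt_of_pos x hpos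
  have hdiv := Int.emod_add_mul_ediv x (4 * m : ℕ)
  rw [← hval] at hv₀ hv₁ hdiv
  generalize x / ((4 * m : ℕ) : ℤ) = t at hdiv
  push_cast at hpos hv₁ hdiv
  have ht₁ : -2 < t := by
    by_contra! h
    nlinarith [mul_le_mul_of_nonneg_left h hpos.le, show -(2 * m : ℤ) < x by omega]
  have ht₂ : t < 2 := by
    by_contra! h
    nlinarith [mul_le_mul_of_nonneg_left h hpos.le, show x ≤ (4 * m : ℤ) by omega]
  interval_cases t <;> split_ifs <;> omega
end

section
/- Let q = 2^k with k ≥ 2 and let n, m be positive integers. Let A be an m×n matrix over ZMod q, s ∈ (ZMod q)^n, and let e' : Fin m → ℤ be integer error terms. Let x ∈ (ZMod q)^m have all entries in {0,1}, let S = {i : x i = 1}, and let r ∈ {0,1}. Form the ciphertext a = Aᵀ x and b = (A s + e) · x + r·(q/2) in ZMod q, where e i is the image of e' i in ZMod q. If the accumulated integer error E = Σ_{i ∈ S} e' i satisfies −q/4 < E ≤ q/4, then Q(b − a · s) = r, i.e., LWE decryption correctly recovers the encrypted bit. -/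
open Matrix

/-- The LWE decryption phase `b - a ⬝ s` is the accumulated error plus the encoded message. -/
theorem lwe_phase_eq {R ι κ : Type*} [CommRing R] [Fintype ι] [Fintype κ] (A : Matrix ι κ R)
    (s : κ → R) (e x : ι → R) (c : R) :
    ((A.mulVec s + e) ⬝ᵥ x + c) - (A.transpose.mulVec x) ⬝ᵥ s = e ⬝ᵥ x + c := by
  have h : (A.transpose.mulVec x) ⬝ᵥ s = A.mulVec s ⬝ᵥ x := by
    rw [Matrix.mulVec_transpose, ← Matrix.dotProduct_mulVec, dotProduct_comm]
  rw [h, add_dotProduct]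
  ring

/-- The dot product with a binary vector is the sum over its support. -/
theorem dotProduct_binary_eq_sum_filter {R ι : Type*} [NonAssocSemiring R] [DecidableEq R]
    [Fintype ι] (e x : ι → R) (hx : ∀ i, x i = 0 ∨ x i = 1) :
    e ⬝ᵥ x = ∑ i ∈ Finset.univ.filter (fun i => x i = 1), e i := by
  rw [Finset.sum_filter]
  refine Finset.sum_congr rfl fun i _ => ?_
  split_ifs with h
  · rw [h, mul_one]
  · rw [(hx i).resolve_right h, mul_zero]

/-- Quantization recovers a bit encoded as a multiple of `q / 2`, up to an error in
`(-q/4, q/4]`, when `4 ∣ q`. -/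
theorem Q_intCast_add_bit {q : ℕ} (hq : 0 < q) (h4 : 4 ∣ q) {E : ℤ} {r : ℕ}
    (hr : r = 0 ∨ r = 1) (hE₁ : -((q : ℤ) / 4) < E) (hE₂ : E ≤ (q : ℤ) / 4) :
    Q q ((E : ZMod q) + (r : ZMod q) * ((q / 2 : ℕ) : ZMod q)) = r := by
  have : NeZero q := ⟨hq.ne'⟩
  have hval : (((E : ZMod q) + (r : ZMod q) * ((q / 2 : ℕ) : ZMod q)).val : ℤ)
      = (E + r * (q / 2 : ℕ)) % q := by
    simp only [← ZMod.val_intCast, Int.cast_add, Int.cast_mul, Int.cast_natCast]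
  unfold Q
  generalize ((E : ZMod q) + (r : ZMod q) * ((q / 2 : ℕ) : ZMod q)).val = v at hval ⊢
  rcases hr with rfl | rfl
  · rcases lt_or_ge E 0 with h | h
    · rw [← Int.add_emod_right, Int.emod_eq_of_lt (by omega) (by omega)] at hval
      exact if_pos (by omega)
    · rw [Int.emod_eq_of_lt (by omega) (by omega)] at hval
      exact if_pos (by omega)
  · rw [Int.emod_eq_of_lt (by omega) (by omega)] at hval
    exact if_neg (by omega)

/-- **Correctness of LWE decryption.** For `q = 2^k` (`k ≥ 2`), matrix `A`, secret `s`,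
integer errors `e'`, binary selection vector `x` with support `S`, and bit `r ∈ {0,1}`,
form the ciphertext `a = Aᵀ x`, `b = (A s + e) ⬝ x + r (q/2)`.  If the accumulated
integer error `E = ∑ i in S, e' i` satisfies `-q/4 < E ≤ q/4`, then
`Q (b - a ⬝ s) = r`. -/
theorem lwe_decryption_correct (q k n m : ℕ) (hq : q = 2 ^ k) (hk : 2 ≤ k)
    (hn : 0 < n) (hm : 0 < m)
    (A : Matrix (Fin m) (Fin n) (ZMod q)) (s : Fin n → ZMod q)
    (e' : Fin m → ℤ) (x : Fin m → ZMod q)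
    (hx : ∀ i, x i = 0 ∨ x i = 1) (r : ℕ) (hr : r = 0 ∨ r = 1)
    (hE₁ : -((q : ℤ) / 4) < ∑ i ∈ Finset.univ.filter (fun i => x i = 1), e' i)
    (hE₂ : (∑ i ∈ Finset.univ.filter (fun i => x i = 1), e' i) ≤ (q : ℤ) / 4) :
    Q q (((A.mulVec s + fun i => ((e' i : ℤ) : ZMod q)) ⬝ᵥ x
          + (r : ZMod q) * ((q / 2 : ℕ) : ZMod q))
        - (A.transpose.mulVec x) ⬝ᵥ s) = r := by
  subst hq
  rw [lwe_phase_eq, dotProduct_binary_eq_sum_filter _ _ hx, ← Int.cast_sum]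
  exact Q_intCast_add_bit (by positivity) (pow_dvd_pow 2 hk) hr hE₁ hE₂
end

section
/- Let q = 2^k with k ≥ 2, let Q : ZMod q → {0,1} be the quantization function, and fix t ∈ ZMod q. Then there exists a unique b̂ ∈ ZMod q such that Q(b̂ − t) = 0 and Q(b̂ + 1 − t) = 1, namely b̂ = t + q/4. Equivalently, t = b̂ − q/4: observing the unique transition point of b ↦ Q(b − t) from 0 to 1 reveals the value t exactly. -/
theorem Q_transition_iff {m : ℕ} (hm : 0 < m) (x : ZMod (4 * m)) :
    (Q (4 * m) x = 0 ∧ Q (4 * m) (x + 1) = 1) ↔ x = (m : ZMod (4 * m)) := by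
  have : NeZero (4 * m) := ⟨by omega⟩
  have : Fact (1 < 4 * m) := ⟨by omega⟩
  have hx : x.val < 4 * m := x.val_lt
  have hm_val : (m : ZMod (4 * m)).val = m := ZMod.val_natCast_of_lt (by omega)
  have h_eq : x = (m : ZMod (4 * m)) ↔ x.val = m := by
    rw [← (ZMod.val_injective (4 * m)).eq_iff, hm_val]
  have h_succ : x.val + 1 = 4 * m ∧ (x + 1).val = 0 ∨
      x.val + 1 < 4 * m ∧ (x + 1).val = x.val + 1 := by
    rw [ZMod.val_add, ZMod.val_one]
    rcases (Nat.add_one_le_of_lt hx).eq_or_lt with h | h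
    · exact Or.inl ⟨h, by rw [h, Nat.mod_self]⟩
    · exact Or.inr ⟨h, Nat.mod_eq_of_lt h⟩
  rw [h_eq]
  unfold Q
  split_ifs <;> simp only [and_true, and_false, true_iff, false_iff] <;> omega

/-- **Transition point of the quantizer reveals the hidden value.** For `q = 2^k`
with `k ≥ 2` and any `t : ZMod q`, the value `bhat = t + q/4` is the unique element
of `ZMod q` with `Q (bhat - t) = 0` and `Q (bhat + 1 - t) = 1`; equivalently,
`t = bhat - q/4` is exactly recovered from the transition point of
`b ↦ Q (b - t)`. -/
theorem quantize_transition_point (q k : ℕ) (hq : q = 2 ^ k) (hk : 2 ≤ k)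
    (t : ZMod q) :
    (Q q ((t + ((q / 4 : ℕ) : ZMod q)) - t) = 0 ∧
      Q q ((t + ((q / 4 : ℕ) : ZMod q)) + 1 - t) = 1) ∧
    ∀ bhat : ZMod q, (Q q (bhat - t) = 0 ∧ Q q (bhat + 1 - t) = 1) →
      bhat = t + ((q / 4 : ℕ) : ZMod q) := by
  obtain ⟨m, rfl⟩ : 4 ∣ q := hq ▸ pow_dvd_pow 2 hk
  have hm : 0 < m := by
    have : 0 < 4 * m := hq ▸ Nat.two_pow_pos k
    omega
  have h_div : 4 * m / 4 = m := by omega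
  rw [h_div]
  simp only [add_sub_right_comm _ (1 : ZMod (4 * m)) t, Q_transition_iff hm]
  exact ⟨add_sub_cancel_left t _, fun _ h => sub_eq_iff_eq_add'.mp h⟩
end

section
/- Let q = 2^k with k ≥ 2, let n be a positive integer, and let Q : ZMod q → {0,1} be the quantization function. Let M be an n×n matrix over ZMod q whose determinant is a unit, with rows a₀, …, a_{n−1} ∈ (ZMod q)^n, and let s ∈ (ZMod q)^n. Suppose b̂ : Fin n → ZMod q satisfies, for every i, Q(b̂ i − aᵢ · s) = 0 and Q(b̂ i + 1 − aᵢ · s) = 1 (i.e., each b̂ i is the transition point of b ↦ Q(b − ⟨aᵢ, s⟩)). Then s = M⁻¹ · (b̂ − (q/4)·𝟙), where 𝟙 is the all-ones vector; in particular, s is uniquely determined by the transition points b̂. -/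
open Matrix

/-- For `4 ∣ q`, the only point at which `Q` jumps from `0` to `1` is `q / 4`. -/
theorem eq_quarter_of_Q_transition {q : ℕ} [NeZero q] (hq : 4 ∣ q) {x : ZMod q}
    (h₀ : Q q x = 0) (h₁ : Q q (x + 1) = 1) : x = ((q / 4 : ℕ) : ZMod q) := by
  have hpos : 0 < q := NeZero.pos q
  have hx : x.val < q := x.val_lt
  have : Fact (1 < q) := ⟨by omega⟩
  have hadd : (x + 1).val = (x.val + 1) % q := by rw [ZMod.val_add, ZMod.val_one]
  have hval : x.val = q / 4 := by
    simp only [Q, hadd, ite_eq_left_iff, ite_eq_right_iff, zero_ne_one, one_ne_zero,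
      imp_false, not_not] at h₀ h₁
    rcases Nat.lt_or_ge (x.val + 1) q with h | h
    · rw [Nat.mod_eq_of_lt h] at h₁
      omega
    · rw [show x.val + 1 = q by omega, Nat.mod_self] at h₁
      omega
  rw [← hval, ZMod.natCast_zmod_val]

/-- **Full active attack on the lattice PUF.** For `q = 2^k` (`k ≥ 2`), let `M` be an
`n × n` matrix over `ZMod q` with unit determinant, whose rows are the chosen
challenge vectors `aᵢ`, and let `s` be the secret.  If each `bhat i` is the transition
point of `b ↦ Q (b - ⟨aᵢ, s⟩)`, i.e. `Q (bhat i - aᵢ ⬝ s) = 0` and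
`Q (bhat i + 1 - aᵢ ⬝ s) = 1`, then `s = M⁻¹ (bhat - (q/4)·𝟙)`; in particular `s` is
uniquely determined by the transition points. -/
theorem active_attack_recovers_secret (q k n : ℕ) (hq : q = 2 ^ k) (hk : 2 ≤ k)
    (hn : 0 < n) (M : Matrix (Fin n) (Fin n) (ZMod q)) (hM : IsUnit M.det)
    (s : Fin n → ZMod q) (bhat : Fin n → ZMod q)
    (hbhat : ∀ i : Fin n,
      Q q (bhat i - (M i) ⬝ᵥ s) = 0 ∧ Q q (bhat i + 1 - (M i) ⬝ᵥ s) = 1) :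
    s = M⁻¹.mulVec (fun i => bhat i - ((q / 4 : ℕ) : ZMod q)) := by
  have h4 : 4 ∣ q := hq ▸ pow_dvd_pow 2 hk
  have : NeZero q := ⟨by rw [hq]; positivity⟩
  have hrhs : (fun i => bhat i - ((q / 4 : ℕ) : ZMod q)) = M *ᵥ s := by
    funext i
    obtain ⟨h₀, h₁⟩ := hbhat i
    rw [add_sub_right_comm] at h₁
    rw [← eq_quarter_of_Q_transition h4 h₀ h₁, sub_sub_cancel]
    rfl
  rw [hrhs, mulVec_mulVec, nonsing_inv_mul M hM, one_mulVec]
end
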